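/- Let N ≥ 2 and let Γ_SW be any stay-with-the-winner strategy: the first channel S(1) is chosen arbitrarily; for j ≥ 2, if Z_{S(j−1)}(j−1) = 1 then S(j) = S(j−1), and if Z_{S(j−1)}(j−1) = 0 then S(j) is some channel different from S(j−1), chosen by an arbitrary (history-dependent) switching rule. Then for every θ ∈ (0,1)^N with a unique maximal coordinate θ_{i*}, the loss is of linear order: there exist constants c_1, c_2 > 0 and T_0 such that c_1·T ≤ L(θ;Γ_SW,T) ≤ c_2·T for all T ≥ T_0. In particular, no stay-with-the-winner strategy is consistent. -/

import Mathlib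

open MeasureTheory ProbabilityTheory Filter
open scoped BigOperators ENNReal

/-- A deterministic medium-access strategy: it maps the history of
(sensed channel, observed outcome) pairs to the channel to be sensed in the next slot. -/
def Strategy (N : ℕ) : Type := List (Fin N × Bool) → Fin N

/-- The history of (channel, outcome) pairs accumulated after `j` (0-indexed) slots, given
the full availability table `ω` (`ω j i = true` iff channel `i` is free in slot `j`). -/
def Strategy.hist {N : ℕ} (Γ : Strategy N) (ω : ℕ → Fin N → Bool) :
    ℕ → List (Fin N × Bool)
  | 0 => []
  | j + 1 =>
    Strategy.hist Γ ω j ++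
      [(Γ (Strategy.hist Γ ω j), ω j (Γ (Strategy.hist Γ ω j)))]

/-- The channel selected by strategy `Γ` at (0-indexed) slot `j`. -/
def Strategy.sel {N : ℕ} (Γ : Strategy N) (ω : ℕ → Fin N → Bool) (j : ℕ) : Fin N :=
  Γ (Γ.hist ω j)

/-- Extension of a finite availability table to all time slots. -/
def extendOut {N T : ℕ} (ω : Fin T → Fin N → Bool) : ℕ → Fin N → Bool :=
  fun j i => if h : j < T then ω ⟨j, h⟩ i else false

/-- The probability of observing the availability table `ω` when each channel `i` is free
in each slot independently with probability `θ i`. -/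
def outWt {N T : ℕ} (θ : Fin N → ℝ) (ω : Fin T → Fin N → Bool) : ℝ :=
  ∏ j : Fin T, ∏ i : Fin N, (if ω j i then θ i else 1 - θ i)

/-- `W B θ T Γ`: the expected number of bits transmitted over a block of `T` slots by the
cognitive user employing strategy `Γ`, when `B` bits are sent each time the sensed channel
is free, i.e. `E_θ[∑_{j=1}^T B · Z_{S(j)}(j)]`. -/
noncomputable def W {N : ℕ} (B : ℝ) (θ : Fin N → ℝ) (T : ℕ) (Γ : Strategy N) : ℝ :=
  ∑ ω : Fin T → Fin N → Bool, outWt θ ω *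
    ∑ j ∈ Finset.range T, (if extendOut ω j (Γ.sel (extendOut ω) j) then B else 0)

/-- `probSel θ T Γ j i`: the probability that strategy `Γ` selects channel `i` at
(0-indexed) slot `j`, under parameter `θ`. -/
noncomputable def probSel {N : ℕ} (θ : Fin N → ℝ) (T : ℕ) (Γ : Strategy N)
    (j : ℕ) (i : Fin N) : ℝ :=
  ∑ ω : Fin T → Fin N → Bool, (if Γ.sel (extendOut ω) j = i then outWt θ ω else 0)

/-- `expY θ T Γ i`: the expected number of slots among the first `T` in which strategy `Γ`
senses channel `i`, i.e. `E_θ[Y_i(T)]`. -/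
noncomputable def expY {N : ℕ} (θ : Fin N → ℝ) (T : ℕ) (Γ : Strategy N) (i : Fin N) : ℝ :=
  ∑ ω : Fin T → Fin N → Bool, outWt θ ω *
    (((Finset.range T).filter fun j => Γ.sel (extendOut ω) j = i).card : ℝ)

/-- The throughput loss of strategy `Γ` over a block of `T` slots, relative to always
sensing a best channel `istar`: `L(θ;Γ,T) = T·B·θ_{i*} − W_Γ(θ,T)`. -/
noncomputable def Loss {N : ℕ} (B : ℝ) (θ : Fin N → ℝ) (istar : Fin N) (T : ℕ)
    (Γ : Strategy N) : ℝ :=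
  T * B * θ istar - W B θ T Γ

/-- A family of strategies (one for each horizon `T`) is consistent if for every
`θ ∈ [0,1]^N` there are `β < 1` and `C > 0` with `L(θ;Γ_T,T) ≤ C·T^β` for all `T ≥ 1`. -/
def Consistent {N : ℕ} (B : ℝ) (Γ : ℕ → Strategy N) : Prop :=
  ∀ θ : Fin N → ℝ, (∀ i, θ i ∈ Set.Icc (0:ℝ) 1) →
    ∀ istar : Fin N, (∀ k, θ k ≤ θ istar) →
      ∃ β C : ℝ, β < 1 ∧ 0 < C ∧
        ∀ T : ℕ, 1 ≤ T → Loss B θ istar T (Γ T) ≤ C * (T : ℝ) ^ β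

/-- The Bayesian expected throughput of strategy `Γ` under prior `f`. -/
noncomputable def WBayes {N : ℕ} (B : ℝ) (T : ℕ) (Γ : Strategy N)
    (f : Measure (Fin N → ℝ)) : ℝ :=
  ∫ θ, W B θ T Γ ∂f

/-- The optimal Bayesian value `V*(f,T) = sup_Γ W_Γ(f,T)`. -/
noncomputable def Vstar {N : ℕ} (B : ℝ) (T : ℕ) (f : Measure (Fin N → ℝ)) : ℝ :=
  ⨆ Γ : Strategy N, WBayes B T Γ f

/-- The Bayesian posterior after sensing channel `i` and observing outcome `z`:
`f_{z_i=1}` has density `θ_i / ∫θ_i f(dθ)` w.r.t. `f`, and `f_{z_i=0}` has density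
`(1−θ_i) / ∫(1−θ_i) f(dθ)` w.r.t. `f`. -/
noncomputable def posterior {N : ℕ} (f : Measure (Fin N → ℝ)) (i : Fin N) (z : Bool) :
    Measure (Fin N → ℝ) :=
  if z then f.withDensity fun θ => ENNReal.ofReal (θ i / ∫ θ', θ' i ∂f)
  else f.withDensity fun θ => ENNReal.ofReal ((1 - θ i) / ∫ θ', (1 - θ' i) ∂f)

/-- Kullback–Leibler divergence between Bernoulli(a) and Bernoulli(b). -/
noncomputable def klBernoulli (a b : ℝ) : ℝ :=
  a * Real.log (a / b) + (1 - a) * Real.log ((1 - a) / (1 - b))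

/-- A stay-with-the-winner (and switch-from-the-loser) strategy: after a history ending
with the pair `(c, b)`, if `b = true` (channel `c` was found free) the same channel `c`
is sensed again, and if `b = false` a channel different from `c` is sensed (chosen by an
arbitrary history-dependent switching rule). The first channel is arbitrary. -/
def IsStayWithWinner {N : ℕ} (Γ : Strategy N) : Prop :=
  ∀ (h : List (Fin N × Bool)) (c : Fin N) (b : Bool),
    (b = true → Γ (h ++ [(c, b)]) = c) ∧ (b = false → Γ (h ++ [(c, b)]) ≠ c)

/-- Averaging a function of the state of one channel over a single slot. -/
lemma sum_slot_weight_mul {N : ℕ} (θ : Fin N → ℝ) (c : Fin N) (f : Bool → ℝ) :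
    ∑ x : Fin N → Bool, (∏ i, if x i then θ i else 1 - θ i) * f (x c) =
      θ c * f true + (1 - θ c) * f false := by
  have factor : ∀ x : Fin N → Bool, (∏ i, if x i then θ i else 1 - θ i) * f (x c) =
      ∏ i, (if x i then θ i else 1 - θ i) * (if i = c then f (x i) else 1) := by
    intro x
    rw [Finset.prod_mul_distrib, Finset.prod_ite_eq' Finset.univ c, if_pos (Finset.mem_univ c)]
  have expand := Finset.prod_univ_sum (fun _ : Fin N => (Finset.univ : Finset Bool))
    (fun i b => (if b then θ i else 1 - θ i) * (if i = c then f b else 1))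
  rw [Fintype.piFinset_univ] at expand
  rw [Finset.sum_congr rfl fun x _ => factor x, ← expand, Fintype.prod_eq_single c]
  · simp
  · intro i hi
    simp [hi]

lemma extendOut_snoc_of_lt {N T : ℕ} (ω : Fin T → Fin N → Bool) (x : Fin N → Bool) {j : ℕ}
    (hj : j < T) :
    extendOut (Fin.snoc (α := fun _ => Fin N → Bool) ω x) j = extendOut ω j := by
  funext i
  simp only [extendOut, hj, Nat.lt_succ_of_lt hj, dite_true]
  rw [show (⟨j, Nat.lt_succ_of_lt hj⟩ : Fin (T + 1)) = Fin.castSucc ⟨j, hj⟩ from rfl,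
    Fin.snoc_castSucc]

lemma extendOut_snoc_self {N T : ℕ} (ω : Fin T → Fin N → Bool) (x : Fin N → Bool) :
    extendOut (Fin.snoc (α := fun _ => Fin N → Bool) ω x) T = x := by
  funext i
  simp only [extendOut, Nat.lt_succ_self, dite_true]
  rw [show (⟨T, Nat.lt_succ_self T⟩ : Fin (T + 1)) = Fin.last T from rfl, Fin.snoc_last]

lemma outWt_snoc {N T : ℕ} (θ : Fin N → ℝ) (ω : Fin T → Fin N → Bool) (x : Fin N → Bool) :
    outWt θ (Fin.snoc (α := fun _ => Fin N → Bool) ω x) =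
      outWt θ ω * ∏ i, if x i then θ i else 1 - θ i := by
  simp only [outWt, Fin.prod_univ_castSucc, Fin.snoc_castSucc, Fin.snoc_last]

/-- The history after `n` slots depends only on the outcomes in those slots. -/
lemma hist_congr {N : ℕ} (Γ : Strategy N) {ω ω' : ℕ → Fin N → Bool} :
    ∀ {n : ℕ}, (∀ j < n, ω j = ω' j) → Γ.hist ω n = Γ.hist ω' n
  | 0, _ => rfl
  | n + 1, h => by
    simp only [Strategy.hist, hist_congr Γ fun j hj => h j (Nat.lt_succ_of_lt hj),
      h n n.lt_succ_self]

/-- The expectation of a function of the history after `T` slots. -/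
noncomputable def expHist {N : ℕ} (θ : Fin N → ℝ) (Γ : Strategy N) (T : ℕ)
    (F : List (Fin N × Bool) → ℝ) : ℝ :=
  ∑ ω : Fin T → Fin N → Bool, outWt θ ω * F (Γ.hist (extendOut ω) T)

lemma expHist_zero {N : ℕ} (θ : Fin N → ℝ) (Γ : Strategy N) (F : List (Fin N × Bool) → ℝ) :
    expHist θ Γ 0 F = F [] := by
  simp [expHist, outWt, Strategy.hist]

/-- Conditioning on the history before the last slot. -/
lemma expHist_succ {N : ℕ} (θ : Fin N → ℝ) (Γ : Strategy N) (T : ℕ)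
    (F : List (Fin N × Bool) → ℝ) :
    expHist θ Γ (T + 1) F = expHist θ Γ T fun h =>
      θ (Γ h) * F (h ++ [(Γ h, true)]) + (1 - θ (Γ h)) * F (h ++ [(Γ h, false)]) := by
  unfold expHist
  rw [← (Fin.snocEquiv fun _ : Fin (T + 1) => Fin N → Bool).sum_comp, Fintype.sum_prod_type,
    Finset.sum_comm]
  refine Finset.sum_congr rfl fun ω _ => ?_
  refine Eq.trans ?_ (congrArg (outWt θ ω * ·) <|
    sum_slot_weight_mul θ (Γ (Γ.hist (extendOut ω) T)) fun b =>
      F (Γ.hist (extendOut ω) T ++ [(Γ (Γ.hist (extendOut ω) T), b)]))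
  rw [Finset.mul_sum]
  refine Finset.sum_congr rfl fun x _ => ?_
  change outWt θ (Fin.snoc (α := fun _ => Fin N → Bool) ω x) *
    F (Γ.hist (extendOut (Fin.snoc (α := fun _ => Fin N → Bool) ω x)) (T + 1)) = _
  rw [outWt_snoc, Strategy.hist, hist_congr Γ fun j hj => extendOut_snoc_of_lt ω x hj,
    extendOut_snoc_self, mul_assoc]

lemma outWt_nonneg {N T : ℕ} {θ : Fin N → ℝ} (hθ : ∀ i, θ i ∈ Set.Ioo (0 : ℝ) 1)
    (ω : Fin T → Fin N → Bool) : 0 ≤ outWt θ ω :=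
  Finset.prod_nonneg fun j _ => Finset.prod_nonneg fun i _ => by
    split_ifs
    · exact (hθ i).1.le
    · exact sub_nonneg.2 (hθ i).2.le

lemma expHist_mono {N : ℕ} {θ : Fin N → ℝ} (hθ : ∀ i, θ i ∈ Set.Ioo (0 : ℝ) 1)
    (Γ : Strategy N) (T : ℕ) {F G : List (Fin N × Bool) → ℝ} (hFG : ∀ h, F h ≤ G h) :
    expHist θ Γ T F ≤ expHist θ Γ T G :=
  Finset.sum_le_sum fun ω _ => mul_le_mul_of_nonneg_left (hFG _) (outWt_nonneg hθ ω)

lemma expHist_const {N : ℕ} (θ : Fin N → ℝ) (Γ : Strategy N) (a : ℝ) :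
    ∀ T : ℕ, expHist θ Γ T (fun _ => a) = a
  | 0 => expHist_zero θ Γ _
  | T + 1 => by
    have average : (fun h : List (Fin N × Bool) => θ (Γ h) * a + (1 - θ (Γ h)) * a) =
        fun _ => a := by
      funext h
      ring
    rw [expHist_succ, average, expHist_const θ Γ a T]

lemma expHist_add {N : ℕ} (θ : Fin N → ℝ) (Γ : Strategy N) (T : ℕ)
    (F G : List (Fin N × Bool) → ℝ) :
    expHist θ Γ T (fun h => F h + G h) = expHist θ Γ T F + expHist θ Γ T G := by
  simp only [expHist, mul_add, Finset.sum_add_distrib]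

/-- If one more slot raises `F` by at most `a` on average, then `F` grows at most linearly. -/
lemma expHist_le_of_drift {N : ℕ} {θ : Fin N → ℝ} (hθ : ∀ i, θ i ∈ Set.Ioo (0 : ℝ) 1)
    (Γ : Strategy N) (F : List (Fin N × Bool) → ℝ) (a : ℝ)
    (drift : ∀ h, θ (Γ h) * F (h ++ [(Γ h, true)]) + (1 - θ (Γ h)) * F (h ++ [(Γ h, false)]) ≤
      F h + a) :
    ∀ T : ℕ, expHist θ Γ T F ≤ F [] + T * a
  | 0 => by simp [expHist_zero]
  | T + 1 => by
    have step := expHist_mono hθ Γ T drift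
    rw [expHist_add θ Γ T F fun _ => a, expHist_const] at step
    have prev := expHist_le_of_drift hθ Γ F a drift T
    rw [expHist_succ]
    push_cast
    linarith

/-- The number of bits transmitted along a history. -/
noncomputable def bits {N : ℕ} (B : ℝ) (h : List (Fin N × Bool)) : ℝ :=
  (h.map fun p => if p.2 then B else 0).sum

lemma bits_append_singleton {N : ℕ} (B : ℝ) (h : List (Fin N × Bool)) (c : Fin N) (b : Bool) :
    bits B (h ++ [(c, b)]) = bits B h + if b then B else 0 := by
  simp [bits]

lemma bits_hist {N : ℕ} (B : ℝ) (Γ : Strategy N) (ω : ℕ → Fin N → Bool) :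
    ∀ n : ℕ, bits B (Γ.hist ω n) = ∑ j ∈ Finset.range n, if ω j (Γ.sel ω j) then B else 0
  | 0 => by simp [bits, Strategy.hist]
  | n + 1 => by
    rw [Strategy.hist, bits_append_singleton, bits_hist B Γ ω n, Finset.sum_range_succ]
    rfl

lemma W_eq_expHist {N : ℕ} (B : ℝ) (θ : Fin N → ℝ) (T : ℕ) (Γ : Strategy N) :
    W B θ T Γ = expHist θ Γ T (bits B) := by
  simp only [W, expHist, bits_hist]

lemma W_nonneg {N : ℕ} {B : ℝ} (hB : 0 ≤ B) {θ : Fin N → ℝ}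
    (hθ : ∀ i, θ i ∈ Set.Ioo (0 : ℝ) 1) (T : ℕ) (Γ : Strategy N) : 0 ≤ W B θ T Γ :=
  Finset.sum_nonneg fun ω _ => mul_nonneg (outWt_nonneg hθ ω) <|
    Finset.sum_nonneg fun j _ => by split_ifs <;> simp [hB]

/-- If every other channel is worse than `istar` by at least `δ`, and `Γ` leaves `istar` as soon
as it is found busy, then `Γ` loses at least a fixed amount per slot, up to a constant. -/
lemma le_Loss_of_gap {N : ℕ} {B : ℝ} (hB : 0 < B) {Γ : Strategy N} (hSW : IsStayWithWinner Γ)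
    {θ : Fin N → ℝ} (hθ : ∀ i, θ i ∈ Set.Ioo (0 : ℝ) 1) {istar : Fin N} {δ : ℝ} (hδ : 0 < δ)
    (gap : ∀ i, i ≠ istar → θ i + δ ≤ θ istar) (T : ℕ) :
    (1 - θ istar) * (B * δ / 2) * T - B * δ / 2 ≤ Loss B θ istar T Γ := by
  set K : ℝ := B * δ / 2 with hK
  have hK_pos : 0 < K := by positivity
  set φ : List (Fin N × Bool) → ℝ := fun h => if Γ h = istar then K else 0 with hφ
  have φ_nonneg : ∀ h, 0 ≤ φ h := fun h => by
    simp only [hφ]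
    split_ifs <;> simp [hK_pos.le]
  have φ_le : ∀ h, φ h ≤ K := fun h => by
    simp only [hφ]
    split_ifs <;> simp [hK_pos.le]
  have drift : ∀ h, θ (Γ h) * (bits B (h ++ [(Γ h, true)]) + φ (h ++ [(Γ h, true)])) +
      (1 - θ (Γ h)) * (bits B (h ++ [(Γ h, false)]) + φ (h ++ [(Γ h, false)])) ≤
      bits B h + φ h + (B * θ istar - (1 - θ istar) * K) := by
    intro h
    have free := mul_le_mul_of_nonneg_left (φ_le (h ++ [(Γ h, true)])) (hθ (Γ h)).1.le
    simp only [bits_append_singleton, if_true, Bool.false_eq_true, if_false]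
    by_cases hc : Γ h = istar
    · have leave : φ (h ++ [(Γ h, false)]) = 0 :=
        if_neg (hc ▸ (hSW h (Γ h) false).2 rfl)
      have here : φ h = K := if_pos hc
      rw [leave, here]
      rw [hc] at free ⊢
      linarith
    · have busy := mul_le_mul_of_nonneg_left (φ_le (h ++ [(Γ h, false)]))
        (sub_nonneg.2 (hθ (Γ h)).2.le)
      have worse := mul_le_mul_of_nonneg_left (gap _ hc) hB.le
      have := φ_nonneg h
      have := mul_pos (hθ istar).1 hK_pos
      linarith
  have bound := expHist_le_of_drift hθ Γ (fun h => bits B h + φ h) _ drift T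
  have drop := expHist_mono hθ Γ T (F := bits B) (G := fun h => bits B h + φ h)
    fun h => le_add_of_nonneg_right (φ_nonneg h)
  have start : bits B ([] : List (Fin N × Bool)) = 0 := by simp [bits]
  have := φ_le []
  rw [Loss, W_eq_expHist]
  linarith

/-- A positive linear function is eventually not bounded by a power with exponent below one. -/
lemma exists_nat_rpow_lt_linear {c C β : ℝ} (hc : 0 < c) (hβ : β < 1) (T₀ : ℕ) :
    ∃ T : ℕ, T₀ ≤ T ∧ 1 ≤ T ∧ C * (T : ℝ) ^ β < c * T := by
  have grows : Tendsto (fun T : ℕ => (T : ℝ) ^ (1 - β)) atTop atTop :=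
    (tendsto_rpow_atTop (sub_pos.2 hβ)).comp tendsto_natCast_atTop_atTop
  obtain ⟨T, hlarge, h_ge, h_one⟩ := ((grows.eventually_gt_atTop (C / c)).and
    ((eventually_ge_atTop T₀).and (eventually_ge_atTop 1))).exists
  refine ⟨T, h_ge, h_one, ?_⟩
  have hT : (0 : ℝ) < T := by exact_mod_cast h_one
  have split : (T : ℝ) = (T : ℝ) ^ (1 - β) * (T : ℝ) ^ β := by
    rw [← Real.rpow_add hT, sub_add_cancel, Real.rpow_one]
  rw [div_lt_iff₀ hc] at hlarge
  calc C * (T : ℝ) ^ β < (T : ℝ) ^ (1 - β) * c * (T : ℝ) ^ β :=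
        mul_lt_mul_of_pos_right hlarge (Real.rpow_pos_of_pos hT β)
    _ = c * ((T : ℝ) ^ (1 - β) * (T : ℝ) ^ β) := by ring
    _ = c * T := by rw [← split]

/-- For `N ≥ 2`, any stay-with-the-winner strategy `Γ_SW`, and any
`θ ∈ (0,1)^N` with a unique maximal coordinate `θ_{i*}`, the loss is of linear order:
`c₁·T ≤ L(θ;Γ_SW,T) ≤ c₂·T` for some `c₁, c₂ > 0` and all large `T`. In particular the
family using `Γ_SW` at every horizon is not consistent (no bound `C·T^β`, `β < 1`). -/
theorem stay_with_winner_linear_loss {N : ℕ} (hN : 2 ≤ N)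
    (B : ℝ) (hB : 0 < B) (Γ : Strategy N) (hSW : IsStayWithWinner Γ)
    (θ : Fin N → ℝ) (hθ : ∀ i, θ i ∈ Set.Ioo (0:ℝ) 1)
    (istar : Fin N) (hmax : ∀ i, i ≠ istar → θ i < θ istar) :
    (∃ c₁ c₂ : ℝ, 0 < c₁ ∧ 0 < c₂ ∧ ∃ T₀ : ℕ, ∀ T : ℕ, T₀ ≤ T →
      c₁ * T ≤ Loss B θ istar T Γ ∧ Loss B θ istar T Γ ≤ c₂ * T) ∧
    ¬ ∃ β C : ℝ, β < 1 ∧ 0 < C ∧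
        ∀ T : ℕ, 1 ≤ T → Loss B θ istar T Γ ≤ C * (T : ℝ) ^ β := by
  obtain ⟨δ, hδ, gap⟩ : ∃ δ : ℝ, 0 < δ ∧ ∀ i, i ≠ istar → θ i + δ ≤ θ istar := by
    have eventually_gap : ∀ᶠ δ : ℝ in nhdsWithin 0 (Set.Ioi 0),
        ∀ i, i ≠ istar → θ i + δ ≤ θ istar := by
      refine eventually_all.2 fun i => eventually_all.2 fun hi => ?_
      filter_upwards [Ioo_mem_nhdsGT (sub_pos.2 (hmax i hi))] with δ hδ
      linarith [hδ.2]
    exact (eventually_nhdsWithin_of_forall (fun _ h => h) |>.and eventually_gap).exists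
  have linear := le_Loss_of_gap hB hSW hθ hδ gap
  set a : ℝ := (1 - θ istar) * (B * δ / 2)
  have ha : 0 < a := mul_pos (sub_pos.2 (hθ istar).2) (by positivity)
  obtain ⟨T₀, hT₀⟩ := exists_nat_ge (B * δ / 2 / (a / 2))
  rw [div_le_iff₀ (half_pos ha)] at hT₀
  have lower : ∀ T : ℕ, T₀ ≤ T → a / 2 * T ≤ Loss B θ istar T Γ := by
    intro T hT
    have hT' : (T₀ : ℝ) ≤ T := by exact_mod_cast hT
    have := mul_le_mul_of_nonneg_right hT' (half_pos ha).le
    linarith [linear T]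
  refine ⟨⟨a / 2, B * θ istar, half_pos ha, mul_pos hB (hθ istar).1, T₀, fun T hT =>
    ⟨lower T hT, ?_⟩⟩, ?_⟩
  · have := W_nonneg hB.le hθ T Γ
    rw [Loss]
    linarith
  · rintro ⟨β, C, hβ, -, upper⟩
    obtain ⟨T, h_ge, h_one, hlt⟩ := exists_nat_rpow_lt_linear (C := C) (half_pos ha) hβ T₀
    linarith [lower T h_ge, upper T h_one]
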